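/- arXiv:0909.1817 — 2 statements merged into one kernel-verified Lean document; each statement's English description precedes it below -/
import Mathlib

section
/- (Optimal correlation, full-rank case.) Assume P₁ > 0, P₂ > 0 and det(H†H) > 0. Let t* = min( |h₁†h₂| / (√(P₁P₂) · det(H†H)), 1) and ρ* = t* · e^{i·arg(h₁†h₂)} (with the convention e^{i·arg(0)} = 1). Then for every ρ ∈ ℂ with |ρ| ≤ 1, det(I_N + H Q_r(ρ) H†) ≤ det(I_N + H Q_r(ρ*) H†). -/
open Matrix Complex Filter

/-- The `N × 2` matrix with columns `h₁` and `h₂`. -/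
noncomputable def Hm {N : ℕ} (h₁ h₂ : Fin N → ℂ) : Matrix (Fin N) (Fin 2) ℂ :=
  Matrix.of fun i j => if j = 0 then h₁ i else h₂ i

/-- The Hermitian inner product `h₁† h₂ = ∑ i, conj (h₁ i) * h₂ i`. -/
noncomputable def ip {N : ℕ} (h₁ h₂ : Fin N → ℂ) : ℂ :=
  ∑ i, (starRingEnd ℂ) (h₁ i) * h₂ i

/-- The squared Euclidean norm `‖h‖²`. -/
noncomputable def nsq {N : ℕ} (h : Fin N → ℂ) : ℝ :=
  ∑ i, Complex.normSq (h i)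

/-- `det (H† H)`, a nonnegative real number (taken via the real part). -/
noncomputable def detHH {N : ℕ} (h₁ h₂ : Fin N → ℂ) : ℝ :=
  (((Hm h₁ h₂)ᴴ * Hm h₁ h₂).det).re

/-- The relay covariance matrix `Q_r(ρ)` with diagonal `P₁, P₂` and
off-diagonal `ρ √(P₁ P₂)`. -/
noncomputable def Qr (P₁ P₂ : ℝ) (ρ : ℂ) : Matrix (Fin 2) (Fin 2) ℂ :=
  !![(P₁ : ℂ), ρ * (Real.sqrt (P₁ * P₂) : ℂ);
     (starRingEnd ℂ) ρ * (Real.sqrt (P₁ * P₂) : ℂ), (P₂ : ℂ)]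

/-- `det (I_N + H Q_r(ρ) H†)` (a real number, taken via the real part). -/
noncomputable def MACdet {N : ℕ} (h₁ h₂ : Fin N → ℂ) (P₁ P₂ : ℝ) (ρ : ℂ) : ℝ :=
  ((1 + Hm h₁ h₂ * Qr P₁ P₂ ρ * (Hm h₁ h₂)ᴴ).det).re

theorem conjTranspose_Hm_mul_Hm {N : ℕ} (h₁ h₂ : Fin N → ℂ) :
    (Hm h₁ h₂)ᴴ * Hm h₁ h₂ =
      !![(nsq h₁ : ℂ), ip h₁ h₂; (starRingEnd ℂ) (ip h₁ h₂), (nsq h₂ : ℂ)] := by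
  ext i j
  fin_cases i <;> fin_cases j <;>
    simp [Hm, Matrix.mul_apply, nsq, ip, Complex.normSq_eq_conj_mul_self, mul_comm]

theorem detHH_eq {N : ℕ} (h₁ h₂ : Fin N → ℂ) :
    detHH h₁ h₂ = nsq h₁ * nsq h₂ - Complex.normSq (ip h₁ h₂) := by
  rw [detHH, conjTranspose_Hm_mul_Hm, Matrix.det_fin_two_of, Complex.mul_conj]
  norm_cast

/-- The determinant of the `N × N` matrix as a function of `ρ`, by Sylvester's identity. -/
theorem MACdet_eq {N : ℕ} (h₁ h₂ : Fin N → ℂ) {P₁ P₂ : ℝ} (hP : 0 ≤ P₁ * P₂) (ρ : ℂ) :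
    MACdet h₁ h₂ P₁ P₂ ρ = 1 + nsq h₁ * P₁ + nsq h₂ * P₂
      + 2 * √(P₁ * P₂) * ((starRingEnd ℂ) (ip h₁ h₂) * ρ).re
      + detHH h₁ h₂ * (√(P₁ * P₂) ^ 2 * (1 - ‖ρ‖ ^ 2)) := by
  have hs : √(P₁ * P₂) ^ 2 = P₁ * P₂ := Real.sq_sqrt hP
  rw [MACdet, Matrix.mul_assoc, Matrix.det_one_add_mul_comm, Matrix.mul_assoc,
    conjTranspose_Hm_mul_Hm, detHH_eq, Qr, ← Complex.normSq_eq_norm_sq]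
  generalize √(P₁ * P₂) = s at *
  simp [Matrix.det_fin_two, Complex.normSq_apply]
  linear_combination (nsq h₁ * nsq h₂ - ((ip h₁ h₂).re ^ 2 + (ip h₁ h₂).im ^ 2)) * (-hs)

/-- The concave quadratic `2 * s * c * t - D * s ^ 2 * t ^ 2` is maximized over `t ≤ 1` at
its vertex, truncated to `1`. -/
theorem quadratic_le_at_min {s c D t : ℝ} (hs : 0 < s) (hD : 0 < D) (ht : t ≤ 1) :
    2 * s * c * t + D * (s ^ 2 * (1 - t ^ 2)) ≤
      2 * s * c * min (c / (s * D)) 1 + D * (s ^ 2 * (1 - min (c / (s * D)) 1 ^ 2)) := by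
  have hsD : 0 < s * D := mul_pos hs hD
  have hc : c = c / (s * D) * (s * D) := by field_simp
  generalize c / (s * D) = v at *
  subst hc
  have hA : 0 ≤ s ^ 2 * D := by positivity
  suffices 0 ≤ (min v 1 - t) * (2 * v - min v 1 - t) by
    linarith [mul_nonneg hA this]
  rcases min_cases v 1 with ⟨h, h'⟩ | ⟨h, h'⟩ <;> rw [h]
  · nlinarith [sq_nonneg (v - t)]
  · exact mul_nonneg (by linarith) (by linarith)

/-- Optimal correlation, full-rank case. If `P₁, P₂ > 0` and
`det(H†H) > 0`, then `ρ* = min(|h₁†h₂|/(√(P₁P₂)·det(H†H)), 1) · e^{i·arg(h₁†h₂)}`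
maximizes `det (I_N + H Q_r(ρ) H†)` over all `ρ` with `|ρ| ≤ 1`. -/
theorem stmt2 {N : ℕ} (hN : 0 < N) (h₁ h₂ : Fin N → ℂ) (P₁ P₂ : ℝ)
    (hP₁ : 0 < P₁) (hP₂ : 0 < P₂) (hD : 0 < detHH h₁ h₂)
    (ρ : ℂ) (hρ : ‖ρ‖ ≤ 1) :
    MACdet h₁ h₂ P₁ P₂ ρ ≤
      MACdet h₁ h₂ P₁ P₂
        (((min (‖ip h₁ h₂‖ / (Real.sqrt (P₁ * P₂) * detHH h₁ h₂)) 1 : ℝ) : ℂ)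
          * Complex.exp (Complex.I * ((ip h₁ h₂).arg : ℂ))) := by
  have hP : 0 < P₁ * P₂ := mul_pos hP₁ hP₂
  have hs : 0 < √(P₁ * P₂) := Real.sqrt_pos.2 hP
  rw [MACdet_eq h₁ h₂ hP.le, MACdet_eq h₁ h₂ hP.le]
  have key := quadratic_le_at_min (c := ‖ip h₁ h₂‖) hs hD hρ
  have ht : 0 ≤ min (‖ip h₁ h₂‖ / (√(P₁ * P₂) * detHH h₁ h₂)) 1 := by positivity
  generalize min (‖ip h₁ h₂‖ / (√(P₁ * P₂) * detHH h₁ h₂)) 1 = t at *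
  have hre : ((starRingEnd ℂ) (ip h₁ h₂) * ρ).re ≤ ‖ip h₁ h₂‖ * ‖ρ‖ := by
    simpa using Complex.re_le_norm ((starRingEnd ℂ) (ip h₁ h₂) * ρ)
  have hnorm : ‖(t : ℂ) * Complex.exp (Complex.I * ((ip h₁ h₂).arg : ℂ))‖ = t := by
    rw [norm_mul, Complex.norm_exp_I_mul_ofReal, Complex.norm_of_nonneg ht, mul_one]
  have halign : (starRingEnd ℂ) (ip h₁ h₂) *
      ((t : ℂ) * Complex.exp (Complex.I * ((ip h₁ h₂).arg : ℂ))) = (‖ip h₁ h₂‖ * t : ℝ) := by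
    generalize ip h₁ h₂ = c
    have hpolar : (‖c‖ : ℂ) * Complex.exp (Complex.I * (c.arg : ℂ)) = c := by
      rw [mul_comm Complex.I, Complex.norm_mul_exp_arg_mul_I]
    rcases eq_or_ne c 0 with rfl | hc
    · simp
    · have hc' : (‖c‖ : ℂ) ≠ 0 := by simpa using hc
      apply mul_left_cancel₀ hc'
      push_cast
      linear_combination (starRingEnd ℂ) c * t * hpolar + t * Complex.conj_mul' c
  rw [hnorm, halign, Complex.ofReal_re]
  linarith [mul_le_mul_of_nonneg_left hre hs.le]
end

section
/- (Orthogonal channel vectors.) Assume P₁ ≥ 0, P₂ ≥ 0 and h₁†h₂ = 0. Then for every ρ ∈ ℂ with |ρ| ≤ 1, det(I_N + H Q_r(ρ) H†) ≤ (1 + P₁‖h₁‖²)(1 + P₂‖h₂‖²), and equality holds at ρ = 0; that is, uncorrelated relay signals maximize the determinant, with maximum value (1 + P₁‖h₁‖²)(1 + P₂‖h₂‖²). -/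
open Matrix Complex Filter

theorem ip_self {N : ℕ} (h : Fin N → ℂ) : ip h h = (nsq h : ℂ) := by
  simp [ip, nsq, Complex.normSq_eq_conj_mul_self]

theorem conj_ip {N : ℕ} (h₁ h₂ : Fin N → ℂ) :
    (starRingEnd ℂ) (ip h₁ h₂) = ip h₂ h₁ := by
  simp [ip, mul_comm]

/-- The Gram matrix of two channel vectors. -/
theorem Hm_conjTranspose_mul_self {N : ℕ} (h₁ h₂ : Fin N → ℂ) :
    (Hm h₁ h₂)ᴴ * Hm h₁ h₂ = !![ip h₁ h₁, ip h₁ h₂; ip h₂ h₁, ip h₂ h₂] := by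
  ext i j
  fin_cases i <;> fin_cases j <;> simp [Matrix.mul_apply, Hm, ip]

theorem MACdet_of_ip_eq_zero {N : ℕ} (h₁ h₂ : Fin N → ℂ) (P₁ P₂ : ℝ)
    (hP₁ : 0 ≤ P₁) (hP₂ : 0 ≤ P₂) (horth : ip h₁ h₂ = 0) (ρ : ℂ) :
    MACdet h₁ h₂ P₁ P₂ ρ = (1 + P₁ * nsq h₁) * (1 + P₂ * nsq h₂)
      - Complex.normSq ρ * (P₁ * P₂) * (nsq h₁ * nsq h₂) := by
  have horth' : ip h₂ h₁ = 0 := by rw [← conj_ip, horth, map_zero]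
  have hs : ((Real.sqrt (P₁ * P₂) : ℝ) : ℂ) * (Real.sqrt (P₁ * P₂) : ℝ) = (P₁ * P₂ : ℝ) := by
    rw [← Complex.ofReal_mul, Real.mul_self_sqrt (mul_nonneg hP₁ hP₂)]
  rw [MACdet, Matrix.mul_assoc, Matrix.det_one_add_mul_comm, Matrix.mul_assoc,
    Hm_conjTranspose_mul_self, horth, horth', ip_self,
    ip_self, Qr, ← Complex.ofReal_re (_ - _)]
  congr 1
  simp only [Matrix.one_fin_two, Matrix.mul_fin_two, Matrix.det_fin_two, Matrix.add_apply,
    Matrix.of_apply, Matrix.cons_val', Matrix.cons_val_zero, Matrix.cons_val_one,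
    Matrix.cons_val_fin_one]
  push_cast [Complex.normSq_eq_conj_mul_self] at hs ⊢
  linear_combination (-(starRingEnd ℂ) ρ * ρ * nsq h₁ * nsq h₂) * hs

/-- Orthogonal channel vectors. If `P₁, P₂ ≥ 0` and `h₁†h₂ = 0`,
then for every `ρ` with `|ρ| ≤ 1`,
`det (I_N + H Q_r(ρ) H†) ≤ (1 + P₁‖h₁‖²)(1 + P₂‖h₂‖²)`, with equality at `ρ = 0`. -/
theorem stmt8 {N : ℕ} (hN : 0 < N) (h₁ h₂ : Fin N → ℂ) (P₁ P₂ : ℝ)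
    (hP₁ : 0 ≤ P₁) (hP₂ : 0 ≤ P₂) (horth : ip h₁ h₂ = 0) :
    (∀ ρ : ℂ, ‖ρ‖ ≤ 1 →
        MACdet h₁ h₂ P₁ P₂ ρ ≤ (1 + P₁ * nsq h₁) * (1 + P₂ * nsq h₂)) ∧
    MACdet h₁ h₂ P₁ P₂ 0 = (1 + P₁ * nsq h₁) * (1 + P₂ * nsq h₂) := by
  refine ⟨fun ρ _ => ?_, ?_⟩
  · rw [MACdet_of_ip_eq_zero h₁ h₂ P₁ P₂ hP₁ hP₂ horth]
    have hn (h : Fin N → ℂ) : 0 ≤ nsq h := Finset.sum_nonneg fun i _ => Complex.normSq_nonneg _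
    have := mul_nonneg (mul_nonneg (Complex.normSq_nonneg ρ) (mul_nonneg hP₁ hP₂))
      (mul_nonneg (hn h₁) (hn h₂))
    linarith
  · rw [MACdet_of_ip_eq_zero h₁ h₂ P₁ P₂ hP₁ hP₂ horth]
    simp
end
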